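/- arXiv:1512.09227 — 4 statements merged into one kernel-verified Lean document; each statement's English description precedes it below -/
import Mathlib

section
/- If Q ∈ ℝ^{n₁×n₁×n₃} is an orthogonal tensor (Q^⊤*Q = Q*Q^⊤ = I), then the t-product with Q preserves the Frobenius norm: for every A ∈ ℝ^{n₁×n₂×n₃}, ‖Q*A‖_F = ‖A‖_F. -/
open scoped BigOperators

noncomputable section

/-- A third-order real tensor of size `n₁ × n₂ × n₃`, with cyclic third index. -/
abbrev T3 (n1 n2 n3 : ℕ) := Fin n1 → Fin n2 → ZMod n3 → ℝ

/-- The t-product of two third-order tensors: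
`C(i,j,:) = ∑ₖ A(i,k,:) ⊛ B(k,j,:)` where `⊛` is circular convolution. -/
def tProd {n1 n2 n4 n3 : ℕ} [NeZero n3] (A : T3 n1 n2 n3) (B : T3 n2 n4 n3) :
    T3 n1 n4 n3 :=
  fun i j t => ∑ k : Fin n2, ∑ s : ZMod n3, A i k s * B k j (t - s)

/-- Unnormalized DFT along the third dimension:
`Â(i,j,ω) = ∑ₜ A(i,j,t) e^{-2πiωt/n₃}`. -/
def dft {n1 n2 n3 : ℕ} [NeZero n3] (A : T3 n1 n2 n3) :
    Fin n1 → Fin n2 → ZMod n3 → ℂ :=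
  fun i j ω => ∑ t : ZMod n3, (A i j t : ℂ) *
    Complex.exp (-2 * Real.pi * Complex.I * ((ω.val : ℂ) * (t.val : ℂ)) / (n3 : ℂ))

/-- Tensor transpose: `Aᵀ(i,j,t) = A(j,i,-t)`, i.e. transpose each frontal slice
and reverse the order of frontal slices `2 … n₃`. -/
def tT {n1 n2 n3 : ℕ} (A : T3 n1 n2 n3) : T3 n2 n1 n3 :=
  fun i j t => A j i (-t)

/-- The identity tensor: first frontal slice is the identity matrix, others zero. -/
def idT (n n3 : ℕ) : T3 n n n3 :=
  fun i j t => if i = j ∧ t = 0 then 1 else 0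

/-- An orthogonal tensor: `Qᵀ*Q = Q*Qᵀ = I`. -/
def IsOrthogonalT {n n3 : ℕ} [NeZero n3] (Q : T3 n n n3) : Prop :=
  tProd (tT Q) Q = idT n n3 ∧ tProd Q (tT Q) = idT n n3

/-- Squared Frobenius norm of a third-order tensor. -/
def frobSq {n1 n2 n3 : ℕ} [NeZero n3] (A : T3 n1 n2 n3) : ℝ :=
  ∑ i : Fin n1, ∑ j : Fin n2, ∑ t : ZMod n3, (A i j t) ^ 2

/-- f-diagonal tensor: every frontal slice is a diagonal matrix. -/
def IsFDiagonal {n1 n2 n3 : ℕ} (S : T3 n1 n2 n3) : Prop :=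
  ∀ (i : Fin n1) (j : Fin n2), (i : ℕ) ≠ (j : ℕ) → ∀ t : ZMod n3, S i j t = 0

/-- The block-circulant matrix of a tensor, with rows and columns indexed by pairs. -/
def bcirc {n1 n2 n3 : ℕ} (A : T3 n1 n2 n3) :
    Matrix (Fin n1 × ZMod n3) (Fin n2 × ZMod n3) ℝ :=
  fun p q => A p.1 q.1 (p.2 - q.2)

/-- The `j`-th lateral slice of a tensor, as a vector. -/
def lateralVec {n1 n2 n3 : ℕ} (A : T3 n1 n2 n3) (j : Fin n2) : Fin n1 × ZMod n3 → ℝ :=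
  fun p => A p.1 j p.2

theorem lateralVec_tProd {n1 n2 n4 n3 : ℕ} [NeZero n3] (A : T3 n1 n2 n3) (B : T3 n2 n4 n3)
    (j : Fin n4) : lateralVec (tProd A B) j = (bcirc A).mulVec (lateralVec B j) := by
  ext ⟨i, t⟩
  simp only [lateralVec, tProd, bcirc, Matrix.mulVec, dotProduct, Fintype.sum_prod_type]
  refine Finset.sum_congr rfl fun k _ => ?_
  exact Fintype.sum_equiv (Equiv.subLeft t) _ _ fun s => by simp

theorem bcirc_tProd {n1 n2 n4 n3 : ℕ} [NeZero n3] (A : T3 n1 n2 n3) (B : T3 n2 n4 n3) :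
    bcirc (tProd A B) = bcirc A * bcirc B := by
  ext ⟨i, t⟩ ⟨j, u⟩
  simp only [tProd, bcirc, Matrix.mul_apply, Fintype.sum_prod_type]
  refine Finset.sum_congr rfl fun k _ => ?_
  refine Fintype.sum_equiv (Equiv.subLeft t) _ _ fun s => ?_
  simp [sub_right_comm]

theorem bcirc_tT {n1 n2 n3 : ℕ} (A : T3 n1 n2 n3) : bcirc (tT A) = (bcirc A).transpose := by
  ext ⟨i, t⟩ ⟨j, u⟩
  simp [bcirc, tT]

theorem bcirc_idT (n n3 : ℕ) : bcirc (idT n n3) = 1 := by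
  ext ⟨i, t⟩ ⟨j, u⟩
  simp [bcirc, idT, Matrix.one_apply, sub_eq_zero]

theorem frobSq_eq_sum_dotProduct {n1 n2 n3 : ℕ} [NeZero n3] (A : T3 n1 n2 n3) :
    frobSq A = ∑ j, lateralVec A j ⬝ᵥ lateralVec A j := by
  simp only [frobSq, lateralVec, dotProduct, Fintype.sum_prod_type, sq]
  exact Finset.sum_comm

/-- t-product with an orthogonal tensor preserves the Frobenius
norm: `‖Q*A‖_F = ‖A‖_F`. -/
theorem tProd_orthogonal_frob {n1 n2 n3 : ℕ} [NeZero n3]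
    (Q : T3 n1 n1 n3) (hQ : IsOrthogonalT Q) (A : T3 n1 n2 n3) :
    Real.sqrt (frobSq (tProd Q A)) = Real.sqrt (frobSq A) := by
  have hmul : (bcirc Q).transpose * bcirc Q = 1 := by
    rw [← bcirc_tT, ← bcirc_tProd, hQ.1, bcirc_idT]
  simp only [frobSq_eq_sum_dotProduct, lateralVec_tProd]
  congr 1
  refine Finset.sum_congr rfl fun j _ => ?_
  rw [Matrix.dotProduct_mulVec, ← Matrix.mulVec_transpose, Matrix.mulVec_mulVec, hmul,
    Matrix.one_mulVec]
end
end

section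
/- Every third-order tensor M ∈ ℝ^{n₁×n₂×n₃} admits a tensor singular value decomposition: there exist orthogonal tensors U ∈ ℝ^{n₁×n₁×n₃} and V ∈ ℝ^{n₂×n₂×n₃} and an f-diagonal tensor S ∈ ℝ^{n₁×n₂×n₃} such that M = U*S*V^⊤. -/
open scoped BigOperators

noncomputable section

open scoped Matrix

/-- Singular bases of a linear map between finite-dimensional inner product spaces: orthonormal
bases of domain and codomain in which the map is diagonal. -/
theorem LinearMap.exists_orthonormalBasis_inner_apply_eq_zero {𝕜 E F : Type*} [RCLike 𝕜]
    [NormedAddCommGroup E] [InnerProductSpace 𝕜 E] [FiniteDimensional 𝕜 E]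
    [NormedAddCommGroup F] [InnerProductSpace 𝕜 F] [FiniteDimensional 𝕜 F]
    {m n : ℕ} (hn : Module.finrank 𝕜 E = n) (hm : Module.finrank 𝕜 F = m) (T : E →ₗ[𝕜] F) :
    ∃ (u : OrthonormalBasis (Fin m) 𝕜 F) (v : OrthonormalBasis (Fin n) 𝕜 E),
      ∀ (i : Fin m) (j : Fin n), (i : ℕ) ≠ j → inner 𝕜 (u i) (T (v j)) = 0 := by
  set v := T.isSymmetric_adjoint_comp_self.eigenvectorBasis hn with hv
  have hinner (i j : Fin n) : inner 𝕜 (T (v i)) (T (v j)) =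
      if i = j then ((T.singularValues j : 𝕜)) ^ 2 else 0 := by
    have hTv : LinearMap.adjoint T (T (v j)) = ((T.singularValues j : 𝕜)) ^ 2 • v j := by
      have := T.isSymmetric_adjoint_comp_self.apply_eigenvectorBasis hn j
      rw [← T.sq_singularValues_fin hn] at this
      rw [← hv] at this
      simpa only [LinearMap.comp_apply, RCLike.ofReal_pow] using this
    rw [← LinearMap.adjoint_inner_right, hTv, inner_smul_right,
      orthonormal_iff_ite.mp v.orthonormal]
    split_ifs <;> simp
  have hrank : Module.finrank 𝕜 (LinearMap.range T) ≤ m := hm ▸ Submodule.finrank_le _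
  have hlt {j : ℕ} (hj : T.singularValues j ≠ 0) : j < n := by
    by_contra! h
    exact hj (T.singularValues_of_finrank_le (hn ▸ h))
  let w : Fin m → F := fun i =>
    if h : (i : ℕ) < n then ((T.singularValues i : 𝕜))⁻¹ • T (v ⟨i, h⟩) else 0
  let s : Set (Fin m) := {i | T.singularValues i ≠ 0}
  have hw : Orthonormal 𝕜 (s.domRestrict w) := by
    rw [orthonormal_iff_ite]
    rintro ⟨i, hi⟩ ⟨j, hj⟩
    have hi' : T.singularValues i ≠ 0 := hi
    have hj' : T.singularValues j ≠ 0 := hj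
    have hjc : (T.singularValues j : 𝕜) ≠ 0 := by exact_mod_cast hj'
    simp only [Set.domRestrict_apply, w, hlt hi', hlt hj', dif_pos, inner_smul_left,
      inner_smul_right, hinner, Subtype.mk.injEq, Fin.ext_iff]
    split_ifs with h
    · rw [h]
      simp only [map_inv₀, RCLike.conj_ofReal]
      field_simp
    · simp
  obtain ⟨u, hu⟩ := hw.exists_orthonormalBasis_extension_of_card_eq (by simpa using hm)
  refine ⟨u, v, fun i j hij => ?_⟩
  by_cases hj : T.singularValues j = 0
  · have : T (v j) = 0 := by
      rw [← inner_self_eq_zero (𝕜 := 𝕜), hinner]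
      simp [hj]
    simp [this]
  · have hjm : (j : ℕ) < m := by
      refine lt_of_lt_of_le ?_ hrank
      rw [← T.singularValues_pos_iff_lt_finrank_range]
      exact (T.singularValues_pos_iff_ne_zero _).mpr hj
    have hjc : (T.singularValues j : 𝕜) ≠ 0 := by exact_mod_cast hj
    have huj : T (v j) = (T.singularValues j : 𝕜) • u ⟨j, hjm⟩ := by
      rw [hu ⟨j, hjm⟩ hj]
      simp [w, hjc]
    rw [huj, inner_smul_right, orthonormal_iff_ite.mp u.orthonormal, if_neg, mul_zero]
    simpa [Fin.ext_iff] using hij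

/-- A pair of unitary matrices diagonalizing a rectangular matrix. -/
structure Matrix.IsSingularPair {𝕜 : Type*} [RCLike 𝕜] {m n : ℕ} (A : Matrix (Fin m) (Fin n) 𝕜)
    (W : Matrix (Fin m) (Fin m) 𝕜 × Matrix (Fin n) (Fin n) 𝕜) : Prop where
  fst_mem : W.1 ∈ Matrix.unitaryGroup (Fin m) 𝕜
  snd_mem : W.2 ∈ Matrix.unitaryGroup (Fin n) 𝕜
  apply_eq_zero : ∀ (i : Fin m) (j : Fin n), (i : ℕ) ≠ j → (W.1ᴴ * A * W.2) i j = 0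

theorem Matrix.exists_isSingularPair {𝕜 : Type*} [RCLike 𝕜] {m n : ℕ}
    (A : Matrix (Fin m) (Fin n) 𝕜) : ∃ W, A.IsSingularPair W := by
  obtain ⟨u, v, h⟩ := LinearMap.exists_orthonormalBasis_inner_apply_eq_zero
    (𝕜 := 𝕜) finrank_euclideanSpace_fin finrank_euclideanSpace_fin (Matrix.toEuclideanLin A)
  refine ⟨(_, _), (EuclideanSpace.basisFun _ 𝕜).toMatrix_orthonormalBasis_mem_unitary u,
    (EuclideanSpace.basisFun _ 𝕜).toMatrix_orthonormalBasis_mem_unitary v, fun i j hij => ?_⟩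
  rw [← h i j hij, Matrix.mul_assoc, Matrix.mul_apply, PiLp.inner_apply]
  refine Finset.sum_congr rfl fun k _ => ?_
  change star (u i k) * (A *ᵥ v j) k = _
  simp [mul_comm]

/-- Singular pairs are preserved by star ring homomorphisms. -/
theorem Matrix.IsSingularPair.map {𝕜 𝕜' : Type*} [RCLike 𝕜] [RCLike 𝕜'] {m n : ℕ}
    {A : Matrix (Fin m) (Fin n) 𝕜} {W} (h : A.IsSingularPair W) (f : 𝕜 →+* 𝕜')
    (hf : Function.Semiconj f star star) :
    (A.map f).IsSingularPair (W.1.map f, W.2.map f) where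
  fst_mem := by
    rw [Matrix.mem_unitaryGroup_iff, Matrix.star_eq_conjTranspose, ← Matrix.conjTranspose_map f hf,
      ← Matrix.map_mul, ← Matrix.star_eq_conjTranspose, Matrix.mem_unitaryGroup_iff.mp h.fst_mem]
    simp
  snd_mem := by
    rw [Matrix.mem_unitaryGroup_iff, Matrix.star_eq_conjTranspose, ← Matrix.conjTranspose_map f hf,
      ← Matrix.map_mul, ← Matrix.star_eq_conjTranspose, Matrix.mem_unitaryGroup_iff.mp h.snd_mem]
    simp
  apply_eq_zero i j hij := by
    rw [← Matrix.conjTranspose_map f hf, ← Matrix.map_mul, ← Matrix.map_mul, Matrix.map_apply,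
      h.apply_eq_zero i j hij, map_zero]

/-- A pointwise solvable family of conditions that is equivariant under negation has an
equivariant solution, provided it has fixed solutions at the fixed points of negation. -/
theorem ZMod.exists_equivariant_choice {N : ℕ} [NeZero N] {α : Type*} (P : ZMod N → α → Prop)
    (σ : α → α) (hσ : Function.Involutive σ) (hP : ∀ ω a, P ω a → P (-ω) (σ a))
    (hex : ∀ ω, ∃ a, P ω a) (hfix : ∀ ω, -ω = ω → ∃ a, P ω a ∧ σ a = a) :
    ∃ f : ZMod N → α, ∀ ω, P ω (f ω) ∧ f (-ω) = σ (f ω) := by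
  classical
  choose g hg using hex
  choose c hc hcσ using hfix
  refine ⟨fun ω => if h : -ω = ω then c ω h else
    if ω.val < (-ω).val then g ω else σ (g (-ω)), fun ω => ?_⟩
  by_cases h : -ω = ω
  · simp only [h, dif_pos]
    exact ⟨hc ω h, (hcσ ω h).symm⟩
  · have h' : ¬ - -ω = -ω := fun e => h (neg_injective e)
    have hval : ω.val ≠ (-ω).val := fun e => h (ZMod.val_injective N e).symm
    simp only [h, h', dif_neg, not_false_eq_true]
    rw [neg_neg]
    rcases lt_or_gt_of_ne hval with hlt | hlt
    · rw [if_pos hlt, if_neg hlt.not_gt]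
      exact ⟨hg ω, rfl⟩
    · rw [if_neg hlt.not_gt, if_pos hlt, hσ]
      exact ⟨by simpa using hP _ _ (hg (-ω)), rfl⟩

/-- The Fourier transform of a tensor along the third index, as a family of complex matrices. -/
def tHat {n1 n2 n3 : ℕ} [NeZero n3] (A : T3 n1 n2 n3) (ω : ZMod n3) :
    Matrix (Fin n1) (Fin n2) ℂ :=
  Matrix.of fun i j => ZMod.dft (fun t => (A i j t : ℂ)) ω

theorem tHat_apply {n1 n2 n3 : ℕ} [NeZero n3] (A : T3 n1 n2 n3) (ω : ZMod n3) (i j) :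
    tHat A ω i j = ∑ t, ZMod.stdAddChar (-(t * ω)) * (A i j t : ℂ) := rfl

theorem tHat_tProd {n1 n2 n3 n4 : ℕ} [NeZero n3] (A : T3 n1 n2 n3) (B : T3 n2 n4 n3)
    (ω : ZMod n3) : tHat (tProd A B) ω = tHat A ω * tHat B ω := by
  ext i j
  simp only [Matrix.mul_apply, tHat_apply, tProd, Complex.ofReal_sum, Complex.ofReal_mul,
    Finset.mul_sum]
  rw [Finset.sum_comm]
  refine Finset.sum_congr rfl fun k _ => ?_
  rw [Finset.sum_comm]
  simp only [Finset.sum_mul]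
  conv_rhs => rw [Finset.sum_comm]
  refine Finset.sum_congr rfl fun s _ => ?_
  rw [← Equiv.sum_comp (Equiv.addRight s)]
  refine Finset.sum_congr rfl fun t _ => ?_
  rw [Equiv.coe_addRight, add_sub_cancel_right, add_mul, neg_add, AddChar.map_add_eq_mul]
  ring

theorem tHat_tT {n1 n2 n3 : ℕ} [NeZero n3] (A : T3 n1 n2 n3) (ω : ZMod n3) :
    tHat (tT A) ω = (tHat A ω)ᴴ := by
  ext i j
  rw [Matrix.conjTranspose_apply, tHat_apply, tHat_apply, star_sum, ← Equiv.sum_comp (Equiv.neg _)]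
  refine Finset.sum_congr rfl fun t _ => ?_
  simp [tT, AddChar.map_neg_eq_conj]

theorem tHat_idT {n n3 : ℕ} [NeZero n3] (ω : ZMod n3) : tHat (idT n n3) ω = 1 := by
  ext i j
  rw [tHat_apply, Finset.sum_eq_single 0]
  · simp [idT, Matrix.one_apply, apply_ite Complex.ofReal]
  · intro t _ ht
    simp [idT, ht]
  · simp

theorem eq_of_dft_ofReal_eq {N : ℕ} [NeZero N] {a b : ZMod N → ℝ}
    (h : ZMod.dft (fun t => (a t : ℂ)) = ZMod.dft (fun t => (b t : ℂ))) : a = b := by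
  funext t
  exact_mod_cast congrFun (ZMod.dft.injective h) t

theorem tHat_injective {n1 n2 n3 : ℕ} [NeZero n3] :
    Function.Injective (tHat : T3 n1 n2 n3 → _) := by
  intro A B h
  funext i j
  exact eq_of_dft_ofReal_eq (funext fun ω => congrFun (congrFun (congrFun h ω) i) j)

theorem tHat_neg {n1 n2 n3 : ℕ} [NeZero n3] (A : T3 n1 n2 n3) (ω : ZMod n3) :
    tHat A (-ω) = (tHat A ω).map (starRingEnd ℂ) := by
  ext i j
  rw [Matrix.map_apply, tHat_apply, tHat_apply, map_sum]
  refine Finset.sum_congr rfl fun t _ => ?_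
  rw [map_mul, ← AddChar.map_neg_eq_conj, Complex.conj_ofReal, mul_neg]

/-- A conjugate-symmetric family of matrices is the Fourier transform of a real tensor. -/
theorem exists_tHat_eq {n1 n2 n3 : ℕ} [NeZero n3] (X : ZMod n3 → Matrix (Fin n1) (Fin n2) ℂ)
    (hX : ∀ ω, X (-ω) = (X ω).map (starRingEnd ℂ)) : ∃ A : T3 n1 n2 n3, tHat A = X := by
  refine ⟨fun i j t => (ZMod.dft.symm (fun ω => X ω i j) t).re, ?_⟩
  funext ω
  ext i j
  have hreal : (fun t => (((ZMod.dft.symm (fun ω => X ω i j) t).re : ℝ) : ℂ)) =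
      ZMod.dft.symm (fun ω => X ω i j) := by
    funext t
    rw [← Complex.conj_eq_iff_re, ZMod.invDFT_apply, smul_eq_mul, map_mul, map_sum,
      ← Equiv.sum_comp (Equiv.neg _)]
    congr 1
    · simp
    · refine Finset.sum_congr rfl fun s _ => ?_
      simp [hX, ← AddChar.map_neg_eq_conj]
  change ZMod.dft (fun t => (((ZMod.dft.symm (fun ω => X ω i j) t).re : ℝ) : ℂ)) ω = X ω i j
  rw [hreal, LinearEquiv.apply_symm_apply]

theorem isOrthogonalT_of_tHat_mem_unitaryGroup {n n3 : ℕ} [NeZero n3] {Q : T3 n n n3}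
    (h : ∀ ω, tHat Q ω ∈ Matrix.unitaryGroup (Fin n) ℂ) : IsOrthogonalT Q := by
  constructor <;> refine tHat_injective (funext fun ω => ?_) <;>
    rw [tHat_tProd, tHat_tT, tHat_idT, ← Matrix.star_eq_conjTranspose]
  · exact Matrix.mem_unitaryGroup_iff'.mp (h ω)
  · exact Matrix.mem_unitaryGroup_iff.mp (h ω)

/-- The Fourier slices of a real tensor admit conjugate-symmetric singular pairs. -/
theorem exists_isSingularPair_tHat {n1 n2 n3 : ℕ} [NeZero n3] (M : T3 n1 n2 n3) :
    ∃ W : ZMod n3 → Matrix (Fin n1) (Fin n1) ℂ × Matrix (Fin n2) (Fin n2) ℂ,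
      ∀ ω, (tHat M ω).IsSingularPair (W ω) ∧
        W (-ω) = ((W ω).1.map (starRingEnd ℂ), (W ω).2.map (starRingEnd ℂ)) := by
  refine ZMod.exists_equivariant_choice (fun ω => (tHat M ω).IsSingularPair)
    (fun W => (W.1.map (starRingEnd ℂ), W.2.map (starRingEnd ℂ))) ?_ ?_ ?_ ?_
  · intro W
    ext <;> simp
  · intro ω W h
    rw [tHat_neg]
    exact h.map _ fun _ => rfl
  · exact fun ω => Matrix.exists_isSingularPair _
  · intro ω hω
    have hreal : tHat M ω = ((tHat M ω).map Complex.re).map Complex.ofRealHom := by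
      have h := tHat_neg M ω
      rw [hω] at h
      ext i j
      exact (Complex.conj_eq_iff_re.mp (congrFun (congrFun h i) j).symm).symm
    obtain ⟨W, hW⟩ := Matrix.exists_isSingularPair ((tHat M ω).map Complex.re)
    refine ⟨(W.1.map Complex.ofRealHom, W.2.map Complex.ofRealHom), ?_, ?_⟩
    · rw [hreal]
      exact hW.map _ fun x => (Complex.conj_ofReal x).symm
    · ext <;> simp

/-- every third-order tensor admits a t-SVD `M = U*S*Vᵀ` with
`U, V` orthogonal tensors and `S` f-diagonal. -/
theorem exists_tSVD {n1 n2 n3 : ℕ} [NeZero n3] (M : T3 n1 n2 n3) :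
    ∃ (U : T3 n1 n1 n3) (S : T3 n1 n2 n3) (V : T3 n2 n2 n3),
      IsOrthogonalT U ∧ IsOrthogonalT V ∧ IsFDiagonal S ∧
      M = tProd (tProd U S) (tT V) := by
  obtain ⟨W, hW⟩ := exists_isSingularPair_tHat M
  obtain ⟨U, hU⟩ := exists_tHat_eq (fun ω => (W ω).1) fun ω => congrArg Prod.fst (hW ω).2
  obtain ⟨V, hV⟩ := exists_tHat_eq (fun ω => (W ω).2) fun ω => congrArg Prod.snd (hW ω).2
  refine ⟨U, tProd (tProd (tT U) M) V, V,
    isOrthogonalT_of_tHat_mem_unitaryGroup fun ω => hU ▸ (hW ω).1.fst_mem,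
    isOrthogonalT_of_tHat_mem_unitaryGroup fun ω => hV ▸ (hW ω).1.snd_mem, ?_, ?_⟩
  · intro i j hij
    refine congrFun (eq_of_dft_ofReal_eq (b := 0) (funext fun ω => ?_))
    change tHat (tProd (tProd (tT U) M) V) ω i j = _
    rw [tHat_tProd, tHat_tProd, tHat_tT, hU, hV, (hW ω).1.apply_eq_zero i j hij]
    simp [ZMod.dft_apply]
  · refine tHat_injective (funext fun ω => ?_)
    have h1 := Matrix.mem_unitaryGroup_iff.mp (hW ω).1.fst_mem
    have h2 := Matrix.mem_unitaryGroup_iff.mp (hW ω).1.snd_mem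
    rw [Matrix.star_eq_conjTranspose] at h1 h2
    simp only [tHat_tProd, tHat_tT, hU, hV]
    rw [Matrix.mul_assoc, Matrix.mul_assoc _ (W ω).2, h2, Matrix.mul_one, ← Matrix.mul_assoc, h1,
      Matrix.one_mul]
end
end

section
/- (Optimality of the truncated t-SVD.) Let M ∈ ℝ^{n₁×n₂×n₃} have a t-SVD M = U*S*V^⊤ with U, V orthogonal tensors and S f-diagonal, such that for every frequency ω ∈ ℤ/n₃ℤ the diagonal entries Ŝ(1,1,ω) ≥ Ŝ(2,2,ω) ≥ … ≥ 0 are real, nonnegative and nonincreasing (so they are the singular values of M̂(:,:,ω)). Then for every k < min(n₁,n₂), the truncation M_k = Σ_{i=1}^{k} U(:,i,:) * S(i,i,:) * V(:,i,:)^⊤ satisfies ‖M − M_k‖_F ≤ ‖M − X*Y‖_F for all X ∈ ℝ^{n₁×k×n₃} and Y ∈ ℝ^{k×n₂×n₃}. -/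
open scoped BigOperators

noncomputable section

/-- The truncated t-SVD `M_k = ∑_{i=1}^{k} U(:,i,:) * S(i,i,:) * V(:,i,:)ᵀ`,
a sum of t-products of lateral slices (n₁×1×n₃), tubes (1×1×n₃) and
transposed lateral slices (1×n₂×n₃). -/
def truncT {n1 n2 n3 : ℕ} [NeZero n3] (U : T3 n1 n1 n3) (S : T3 n1 n2 n3)
    (V : T3 n2 n2 n3) (k : ℕ) (hk1 : k ≤ n1) (hk2 : k ≤ n2) : T3 n1 n2 n3 :=
  ∑ i : Fin k,
    tProd
      (tProd (fun a (_ : Fin 1) t => U a (Fin.castLE hk1 i) t)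
             (fun (_ : Fin 1) (_ : Fin 1) t => S (Fin.castLE hk1 i) (Fin.castLE hk2 i) t))
      (tT (fun b (_ : Fin 1) t => V b (Fin.castLE hk2 i) t))

/-- The additive character form of the discrete Fourier transform. -/
theorem dft_eq_sum_stdAddChar {n1 n2 n3 : ℕ} [NeZero n3] (A : T3 n1 n2 n3)
    (i : Fin n1) (j : Fin n2) (ω : ZMod n3) :
    dft A i j ω = ∑ t : ZMod n3, (A i j t : ℂ) * ZMod.stdAddChar (-(t * ω)) := by
  refine Finset.sum_congr rfl fun t _ => ?_
  have h : (-(t * ω)) = ((-(t.val * ω.val : ℤ) : ℤ) : ZMod n3) := by simp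
  rw [h, ZMod.stdAddChar_coe]
  congr 2
  push_cast
  ring

/-- The frontal slice at frequency `ω` of the Fourier transform of a tensor. -/
def fourierSlice {n1 n2 n3 : ℕ} [NeZero n3] (A : T3 n1 n2 n3) (ω : ZMod n3) :
    Matrix (Fin n1) (Fin n2) ℂ :=
  Matrix.of fun i j => dft A i j ω

theorem fourierSlice_apply {n1 n2 n3 : ℕ} [NeZero n3] (A : T3 n1 n2 n3) (ω : ZMod n3)
    (i : Fin n1) (j : Fin n2) :
    fourierSlice A ω i j = ∑ t : ZMod n3, (A i j t : ℂ) * ZMod.stdAddChar (-(t * ω)) :=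
  dft_eq_sum_stdAddChar A i j ω

theorem fourierSlice_tProd {n1 n2 n4 n3 : ℕ} [NeZero n3] (A : T3 n1 n2 n3) (B : T3 n2 n4 n3)
    (ω : ZMod n3) : fourierSlice (tProd A B) ω = fourierSlice A ω * fourierSlice B ω := by
  ext i j
  simp only [Matrix.mul_apply, fourierSlice_apply, tProd, Complex.ofReal_sum, Finset.sum_mul]
  rw [Finset.sum_comm]
  refine Finset.sum_congr rfl fun l _ => ?_
  rw [Finset.sum_comm]
  refine Finset.sum_congr rfl fun s _ => ?_
  rw [Finset.mul_sum, ← Equiv.sum_comp (Equiv.addRight s)]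
  refine Finset.sum_congr rfl fun t _ => ?_
  have h : -((t + s) * ω) = -(s * ω) + -(t * ω) := by ring
  rw [Equiv.coe_addRight, add_sub_cancel_right, h, AddChar.map_add_eq_mul]
  push_cast
  ring

theorem fourierSlice_tT {n1 n2 n3 : ℕ} [NeZero n3] (A : T3 n1 n2 n3) (ω : ZMod n3) :
    fourierSlice (tT A) ω = (fourierSlice A ω).conjTranspose := by
  ext i j
  simp only [Matrix.conjTranspose_apply, fourierSlice_apply, tT, star_sum]
  rw [← Equiv.sum_comp (Equiv.neg _)]
  refine Finset.sum_congr rfl fun t _ => ?_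
  simp [AddChar.map_neg_eq_conj]

theorem fourierSlice_idT (n n3 : ℕ) [NeZero n3] (ω : ZMod n3) :
    fourierSlice (idT n n3) ω = 1 := by
  ext i j
  rw [fourierSlice_apply, Matrix.one_apply, Finset.sum_eq_single 0]
  · by_cases h : i = j <;> simp [idT, h]
  · intro t _ ht
    simp [idT, ht]
  · simp

theorem fourierSlice_sub {n1 n2 n3 : ℕ} [NeZero n3] (A B : T3 n1 n2 n3) (ω : ZMod n3) :
    fourierSlice (A - B) ω = fourierSlice A ω - fourierSlice B ω := by
  ext i j
  simp [fourierSlice_apply, sub_mul]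

theorem fourierSlice_sum {ι : Type*} {n1 n2 n3 : ℕ} [NeZero n3] (s : Finset ι)
    (A : ι → T3 n1 n2 n3) (ω : ZMod n3) :
    fourierSlice (∑ l ∈ s, A l) ω = ∑ l ∈ s, fourierSlice (A l) ω := by
  ext i j
  simp only [Matrix.sum_apply, fourierSlice_apply, Finset.sum_apply, Complex.ofReal_sum,
    Finset.sum_mul]
  exact Finset.sum_comm

/-- Squared Frobenius norm of a complex matrix. -/
def matFrobSq {m n : ℕ} (A : Matrix (Fin m) (Fin n) ℂ) : ℝ :=
  ∑ i, ∑ j, ‖A i j‖ ^ 2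

theorem ofReal_matFrobSq {m n : ℕ} (A : Matrix (Fin m) (Fin n) ℂ) :
    (matFrobSq A : ℂ) = (A.conjTranspose * A).trace := by
  simp only [matFrobSq, Matrix.trace, Matrix.diag, Matrix.mul_apply, Matrix.conjTranspose_apply]
  rw [Finset.sum_comm]
  push_cast
  refine Finset.sum_congr rfl fun i _ => Finset.sum_congr rfl fun j _ => ?_
  exact (Complex.conj_mul' _).symm

theorem matFrobSq_unitary_mul {m n : ℕ} {W : Matrix (Fin m) (Fin m) ℂ}
    (hW : W.conjTranspose * W = 1) (A : Matrix (Fin m) (Fin n) ℂ) :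
    matFrobSq (W * A) = matFrobSq A := by
  apply Complex.ofReal_injective
  rw [ofReal_matFrobSq, ofReal_matFrobSq, Matrix.conjTranspose_mul, Matrix.mul_assoc,
    ← Matrix.mul_assoc _ W, hW, Matrix.one_mul]

theorem matFrobSq_mul_unitary {m n : ℕ} {W : Matrix (Fin n) (Fin n) ℂ}
    (hW : W * W.conjTranspose = 1) (A : Matrix (Fin m) (Fin n) ℂ) :
    matFrobSq (A * W) = matFrobSq A := by
  apply Complex.ofReal_injective
  rw [ofReal_matFrobSq, ofReal_matFrobSq, Matrix.trace_mul_comm, Matrix.conjTranspose_mul,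
    Matrix.mul_assoc, ← Matrix.mul_assoc W, hW, Matrix.one_mul, Matrix.trace_mul_comm]

/-- Parseval's identity for a real function on `ZMod N`. -/
theorem sum_norm_sq_sum_mul_stdAddChar {N : ℕ} [NeZero N] (a : ZMod N → ℝ) :
    ∑ ω : ZMod N, ‖∑ t : ZMod N, (a t : ℂ) * ZMod.stdAddChar (-(t * ω))‖ ^ 2
      = N * ∑ t : ZMod N, a t ^ 2 := by
  apply Complex.ofReal_injective
  push_cast
  simp only [← Complex.conj_mul', map_sum, map_mul, Complex.conj_ofReal,
    ← AddChar.map_neg_eq_conj, neg_neg, Finset.sum_mul_sum]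
  have h (s t ω : ZMod N) : (a s : ℂ) * ZMod.stdAddChar (s * ω) *
      (a t * ZMod.stdAddChar (-(t * ω))) = a s * a t * ZMod.stdAddChar (ω * (s - t)) := by
    have h' : ω * (s - t) = s * ω + -(t * ω) := by ring
    rw [h', AddChar.map_add_eq_mul]
    ring
  simp only [h]
  rw [Finset.sum_comm, Finset.mul_sum]
  refine Finset.sum_congr rfl fun s _ => ?_
  rw [Finset.sum_comm]
  simp only [← Finset.mul_sum, AddChar.sum_mulShift _ (ZMod.isPrimitive_stdAddChar N),
    sub_eq_zero, ZMod.card]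
  simp
  ring

theorem sum_matFrobSq_fourierSlice {n1 n2 n3 : ℕ} [NeZero n3] (A : T3 n1 n2 n3) :
    ∑ ω : ZMod n3, matFrobSq (fourierSlice A ω) = n3 * frobSq A := by
  simp only [matFrobSq, frobSq, fourierSlice_apply, Finset.mul_sum]
  rw [Finset.sum_comm]
  refine Finset.sum_congr rfl fun i _ => ?_
  rw [Finset.sum_comm]
  refine Finset.sum_congr rfl fun j _ => ?_
  rw [sum_norm_sq_sum_mul_stdAddChar, Finset.mul_sum]

/-- A weighted sum of a nonincreasing nonnegative sequence, with weights in `[0, 1]` of total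
at most `k`, is at most the sum of the first `k` terms. -/
theorem sum_mul_le_sum_of_antitone {n k : ℕ} (hk : k ≤ n) {a : ℕ → ℝ} (ha : Antitone a)
    (ha0 : ∀ i, 0 ≤ a i) {p : Fin n → ℝ} (hp0 : ∀ j, 0 ≤ p j) (hp1 : ∀ j, p j ≤ 1)
    (hp : ∑ j, p j ≤ k) :
    ∑ j : Fin n, a j * p j ≤ ∑ j : Fin n, if (j : ℕ) < k then a j else 0 := by
  have hcard : ∑ j : Fin n, (if (j : ℕ) < k then (1 : ℝ) else 0) = k := by
    rw [Fin.sum_univ_eq_sum_range (fun j => if j < k then (1 : ℝ) else 0) n,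
      ← Finset.sum_filter]
    have : (Finset.range n).filter (· < k) = Finset.range k := by
      ext i
      simp only [Finset.mem_filter, Finset.mem_range]
      omega
    simp [this]
  have hterm (j : Fin n) : a j * p j - (if (j : ℕ) < k then a j else 0) ≤
      a k * (p j - if (j : ℕ) < k then (1 : ℝ) else 0) := by
    split_ifs with h
    · nlinarith [ha h.le, hp1 j]
    · nlinarith [ha (not_lt.mp h), hp0 j]
  have hsum := Finset.sum_le_sum fun j (_ : j ∈ Finset.univ) => hterm j
  rw [← Finset.mul_sum, Finset.sum_sub_distrib, Finset.sum_sub_distrib, hcard] at hsum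
  nlinarith [ha0 k]

/-- The distance from `x` to a subspace, in terms of an orthonormal basis of the subspace. -/
theorem norm_sq_sub_sum_inner_le {E ι : Type*} [NormedAddCommGroup E] [InnerProductSpace ℂ E]
    [Fintype ι] {K : Submodule ℂ E} [FiniteDimensional ℂ K] (b : OrthonormalBasis ι ℂ K)
    (x : E) {w : E} (hw : w ∈ K) :
    ‖x‖ ^ 2 - ∑ l, ‖inner ℂ (b l : E) x‖ ^ 2 ≤ ‖x - w‖ ^ 2 := by
  have h1 : ∑ l, ‖inner ℂ (b l : E) x‖ ^ 2 = ‖K.orthogonalProjectionOnto x‖ ^ 2 := by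
    rw [← b.sum_sq_norm_inner_right]
    simp
  have h2 := K.norm_sq_eq_add_norm_sq_projection x
  have h3 : Kᗮ.orthogonalProjectionOnto x = Kᗮ.orthogonalProjectionOnto (x - w) := by
    have : Kᗮ.orthogonalProjectionOnto w = 0 := by
      rw [Submodule.orthogonalProjectionOnto_eq_zero_iff]
      exact K.le_orthogonal_orthogonal hw
    rw [map_sub, this, sub_zero]
  have h4 : ‖Kᗮ.orthogonalProjectionOnto (x - w)‖ ≤ ‖x - w‖ :=
    Submodule.norm_orthogonalProjectionOnto_apply_le _ _
  rw [h1, h2, h3, add_sub_cancel_left]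
  gcongr

/-- The rectangular diagonal matrix with real diagonal entries `s 0, s 1, …`. -/
def rectDiagonal (m n : ℕ) (s : ℕ → ℝ) : Matrix (Fin m) (Fin n) ℂ :=
  Matrix.of fun i j => if (i : ℕ) = j then (s i : ℂ) else 0

/-- The `j`-th standard basis vector of `ℂᵐ`, or zero when `m ≤ j`. -/
def natBasisVec (m j : ℕ) : EuclideanSpace ℂ (Fin m) :=
  WithLp.toLp 2 fun i => if (i : ℕ) = j then 1 else 0

theorem norm_sq_natBasisVec (m j : ℕ) : ‖natBasisVec m j‖ ^ 2 = if j < m then 1 else 0 := by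
  rw [EuclideanSpace.norm_sq_eq]
  have (i : Fin m) : ‖natBasisVec m j i‖ ^ 2 = if (i : ℕ) = j then (1 : ℝ) else 0 := by
    simp only [natBasisVec]
    split_ifs <;> simp
  simp only [this]
  split_ifs with h
  · rw [Finset.sum_eq_single ⟨j, h⟩] <;> simp +contextual [Fin.ext_iff]
  · exact Finset.sum_eq_zero fun i _ => if_neg (by omega)

theorem sum_norm_sq_inner_natBasisVec_le {m n : ℕ} (v : EuclideanSpace ℂ (Fin m)) :
    ∑ j : Fin n, ‖inner ℂ v (natBasisVec m j)‖ ^ 2 ≤ ‖v‖ ^ 2 := by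
  have h (j : Fin n) : ‖inner ℂ v (natBasisVec m j)‖ ^ 2 =
      ∑ i : Fin m, if (i : ℕ) = j then ‖v i‖ ^ 2 else 0 := by
    rw [PiLp.inner_apply]
    simp only [natBasisVec]
    by_cases hj : (j : ℕ) < m
    · rw [Finset.sum_eq_single ⟨j, hj⟩, Finset.sum_eq_single ⟨j, hj⟩] <;>
        simp +contextual [Fin.ext_iff]
    · have hne (i : Fin m) : (i : ℕ) ≠ j := by omega
      simp [hne]
  simp only [h]
  rw [Finset.sum_comm, EuclideanSpace.norm_sq_eq]
  refine Finset.sum_le_sum fun i _ => ?_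
  by_cases hi : (i : ℕ) < n
  · rw [Finset.sum_eq_single ⟨i, hi⟩] <;> simp +contextual [Fin.ext_iff, eq_comm]
  · have hne (j : Fin n) : (i : ℕ) ≠ j := by omega
    simp [hne]

theorem matFrobSq_eq_sum_norm_col {m n : ℕ} (A : Matrix (Fin m) (Fin n) ℂ) :
    matFrobSq A = ∑ j, ‖(WithLp.toLp 2 (A.col j) : EuclideanSpace ℂ (Fin m))‖ ^ 2 := by
  simp only [EuclideanSpace.norm_sq_eq, matFrobSq]
  exact Finset.sum_comm

theorem toLp_col_rectDiagonal {m n : ℕ} (s : ℕ → ℝ) (j : Fin n) :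
    WithLp.toLp 2 ((rectDiagonal m n s).col j) = (s j : ℂ) • natBasisVec m j := by
  ext i
  by_cases h : (i : ℕ) = j <;> simp [rectDiagonal, natBasisVec, h]

/-- **Eckart–Young theorem** in Frobenius norm for a rectangular diagonal matrix. -/
theorem matFrobSq_rectDiagonal_sub_le {m n k : ℕ} (hkm : k ≤ m) (hkn : k ≤ n) {s : ℕ → ℝ}
    (hs : Antitone s) (hs0 : ∀ i, 0 ≤ s i) (P : Matrix (Fin m) (Fin k) ℂ)
    (Q : Matrix (Fin k) (Fin n) ℂ) :
    matFrobSq (rectDiagonal m n fun i => if i < k then 0 else s i) ≤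
      matFrobSq (rectDiagonal m n s - P * Q) := by
  let c : Fin k → EuclideanSpace ℂ (Fin m) := fun l => WithLp.toLp 2 (P.col l)
  let K : Submodule ℂ (EuclideanSpace ℂ (Fin m)) := Submodule.span ℂ (Set.range c)
  have hK : Module.finrank ℂ K ≤ k := (finrank_range_le_card c).trans_eq (Fintype.card_fin k)
  let b := stdOrthonormalBasis ℂ K
  let p : Fin n → ℝ := fun j =>
    ∑ l, ‖inner ℂ (b l : EuclideanSpace ℂ (Fin m)) (natBasisVec m j)‖ ^ 2
  have hp0 (j : Fin n) : 0 ≤ p j := Finset.sum_nonneg fun l _ => by positivity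
  have hp1 (j : Fin n) : p j ≤ 1 := by
    have h := b.orthonormal.comp_linearIsometry K.subtypeₗᵢ |>.sum_inner_products_le
      (s := Finset.univ) (natBasisVec m j)
    refine h.trans ?_
    rw [norm_sq_natBasisVec]
    split_ifs <;> norm_num
  have hp : ∑ j, p j ≤ k := by
    rw [Finset.sum_comm]
    calc _ ≤ ∑ l, ‖(b l : EuclideanSpace ℂ (Fin m))‖ ^ 2 :=
          Finset.sum_le_sum fun l _ => sum_norm_sq_inner_natBasisVec_le _
      _ = ∑ _l : Fin (Module.finrank ℂ K), (1 : ℝ) :=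
          Finset.sum_congr rfl fun l _ => by
            rw [← Submodule.coe_norm, b.norm_eq_one, one_pow]
      _ = Module.finrank ℂ K := by simp
      _ ≤ k := by exact_mod_cast hK
  have hweights := sum_mul_le_sum_of_antitone hkn (a := fun i => s i ^ 2)
    (fun i j h => pow_le_pow_left₀ (hs0 j) (hs h) 2) (fun i => sq_nonneg _) hp0 hp1 hp
  have hcol (j : Fin n) : s j ^ 2 * ‖natBasisVec m j‖ ^ 2 - s j ^ 2 * p j ≤
      ‖(WithLp.toLp 2 ((rectDiagonal m n s - P * Q).col j) : EuclideanSpace ℂ (Fin m))‖ ^ 2 := by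
    have hmem : (WithLp.toLp 2 ((P * Q).col j) : EuclideanSpace ℂ (Fin m)) ∈ K := by
      have : (WithLp.toLp 2 ((P * Q).col j) : EuclideanSpace ℂ (Fin m)) = ∑ l, Q l j • c l := by
        ext i
        simp [c, Matrix.mul_apply, mul_comm]
      rw [this]
      exact Submodule.sum_mem _ fun l _ =>
        Submodule.smul_mem _ _ (Submodule.subset_span ⟨l, rfl⟩)
    have h := norm_sq_sub_sum_inner_le b ((s j : ℂ) • natBasisVec m j) hmem
    have hsub : (WithLp.toLp 2 ((rectDiagonal m n s - P * Q).col j) : EuclideanSpace ℂ (Fin m)) =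
        WithLp.toLp 2 ((rectDiagonal m n s).col j) - WithLp.toLp 2 ((P * Q).col j) := rfl
    rw [hsub, toLp_col_rectDiagonal]
    simp only [inner_smul_right, norm_smul, norm_mul, mul_pow, Complex.norm_real,
      Real.norm_eq_abs, sq_abs, ← Finset.mul_sum] at h
    exact h
  rw [matFrobSq_eq_sum_norm_col, matFrobSq_eq_sum_norm_col]
  have htail (j : Fin n) :
      ‖(WithLp.toLp 2 ((rectDiagonal m n fun i => if i < k then 0 else s i).col j) :
        EuclideanSpace ℂ (Fin m))‖ ^ 2 =
      s j ^ 2 * ‖natBasisVec m j‖ ^ 2 - if (j : ℕ) < k then s j ^ 2 else 0 := by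
    rw [toLp_col_rectDiagonal, norm_smul, mul_pow, norm_sq_natBasisVec]
    by_cases h : (j : ℕ) < k
    · simp [h, h.trans_le hkm]
    · simp [h]
  have hsum := Finset.sum_le_sum fun j (_ : j ∈ Finset.univ) => hcol j
  simp only [htail]
  rw [Finset.sum_sub_distrib] at hsum ⊢
  linarith

/-- The Fourier slices of the truncated t-SVD are truncated singular value decompositions. -/
theorem fourierSlice_truncT {n1 n2 n3 : ℕ} [NeZero n3] (U : T3 n1 n1 n3) (S : T3 n1 n2 n3)
    (V : T3 n2 n2 n3) {k : ℕ} (hk1 : k ≤ n1) (hk2 : k ≤ n2) {s : ℕ → ℝ} {ω : ZMod n3}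
    (hs : fourierSlice S ω = rectDiagonal n1 n2 s) :
    fourierSlice (truncT U S V k hk1 hk2) ω =
      fourierSlice U ω * rectDiagonal n1 n2 (fun i => if i < k then s i else 0) *
        (fourierSlice V ω).conjTranspose := by
  have hdiag (l : Fin k) : fourierSlice (fun (_ _ : Fin 1) t =>
      S (Fin.castLE hk1 l) (Fin.castLE hk2 l) t) ω 0 0 = s l := by
    change fourierSlice S ω (Fin.castLE hk1 l) (Fin.castLE hk2 l) = s l
    simp [hs, rectDiagonal]
  rw [truncT, fourierSlice_sum]
  ext i j
  simp only [Matrix.sum_apply, fourierSlice_tProd, fourierSlice_tT, Matrix.mul_apply,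
    Fin.sum_univ_one, hdiag, Matrix.conjTranspose_apply]
  refine Fintype.sum_of_injective (Fin.castLE hk2) (Fin.castLE_injective hk2) _ _ ?_ fun l => ?_
  · intro c hc
    have hck : ¬ (c : ℕ) < k := fun h => hc ⟨⟨c, h⟩, rfl⟩
    rw [Finset.sum_eq_zero, zero_mul]
    intro b _
    by_cases hbc : (b : ℕ) = c <;> simp [rectDiagonal, hbc, hck]
  · rw [Finset.sum_eq_single (Fin.castLE hk1 l)]
    · simp only [rectDiagonal, Matrix.of_apply, Fin.val_castLE, if_true, l.isLt]
      rfl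
    · intro b _ hb
      have : (b : ℕ) ≠ l := fun h => hb (Fin.ext h)
      simp [rectDiagonal, this]
    · simp

theorem exists_fourierSlice_eq_rectDiagonal {n1 n2 n3 : ℕ} [NeZero n3] {S : T3 n1 n2 n3}
    (hS : IsFDiagonal S) (ω : ZMod n3)
    (hdiag : ∀ (i : Fin n1) (j : Fin n2), (i : ℕ) = (j : ℕ) →
      (dft S i j ω).im = 0 ∧ 0 ≤ (dft S i j ω).re)
    (hmono : ∀ (i i' : Fin n1) (j j' : Fin n2),
      (i : ℕ) = (j : ℕ) → (i' : ℕ) = (j' : ℕ) → (i : ℕ) ≤ (i' : ℕ) →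
      (dft S i' j' ω).re ≤ (dft S i j ω).re) :
    ∃ s : ℕ → ℝ, Antitone s ∧ (∀ i, 0 ≤ s i) ∧ fourierSlice S ω = rectDiagonal n1 n2 s := by
  refine ⟨fun l => if h : l < n1 ∧ l < n2 then (dft S ⟨l, h.1⟩ ⟨l, h.2⟩ ω).re else 0,
    fun l l' hl => ?_, fun l => ?_, ?_⟩
  · by_cases h' : l' < n1 ∧ l' < n2
    · have h : l < n1 ∧ l < n2 := by omega
      simpa only [h, h', and_self, dif_pos] using
        hmono ⟨l, h.1⟩ ⟨l', h'.1⟩ ⟨l, h.2⟩ ⟨l', h'.2⟩ rfl rfl hl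
    · simp only [h', dif_neg, not_false_eq_true]
      split_ifs with h
      · exact (hdiag _ _ rfl).2
      · exact le_rfl
  · dsimp only
    split_ifs with h
    · exact (hdiag _ _ rfl).2
    · exact le_rfl
  · ext i j
    by_cases h : (i : ℕ) = j
    · have hi : (i : ℕ) < n1 ∧ (i : ℕ) < n2 := by omega
      have hj : j = ⟨i, hi.2⟩ := Fin.ext h.symm
      subst hj
      simp only [rectDiagonal, Matrix.of_apply, if_true, dif_pos hi]
      exact Complex.ext rfl (hdiag _ _ rfl).1
    · simp [fourierSlice_apply, rectDiagonal, h, hS i j h]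

/-- optimality of the truncated t-SVD: if `M = U*S*Vᵀ` is a t-SVD
whose Fourier-domain diagonal entries `Ŝ(i,i,ω)` are real, nonnegative and
nonincreasing in `i` for every ω, then for every `k < min n₁ n₂` the truncation
`M_k` is a best approximation of `M` in Frobenius norm among all products `X*Y`
with `X ∈ ℝ^{n₁×k×n₃}`, `Y ∈ ℝ^{k×n₂×n₃}`. -/
theorem truncated_tSVD_optimal {n1 n2 n3 : ℕ} [NeZero n3]
    (M : T3 n1 n2 n3) (U : T3 n1 n1 n3) (S : T3 n1 n2 n3) (V : T3 n2 n2 n3)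
    (hU : IsOrthogonalT U) (hV : IsOrthogonalT V) (hS : IsFDiagonal S)
    (hM : M = tProd (tProd U S) (tT V))
    (hdiag : ∀ (ω : ZMod n3) (i : Fin n1) (j : Fin n2), (i : ℕ) = (j : ℕ) →
      (dft S i j ω).im = 0 ∧ 0 ≤ (dft S i j ω).re)
    (hmono : ∀ (ω : ZMod n3) (i i' : Fin n1) (j j' : Fin n2),
      (i : ℕ) = (j : ℕ) → (i' : ℕ) = (j' : ℕ) → (i : ℕ) ≤ (i' : ℕ) →
      (dft S i' j' ω).re ≤ (dft S i j ω).re)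
    (k : ℕ) (hk : k < min n1 n2) :
    ∀ (X : T3 n1 k n3) (Y : T3 k n2 n3),
      Real.sqrt (frobSq (M - truncT U S V k (by omega) (by omega))) ≤
        Real.sqrt (frobSq (M - tProd X Y)) := by
  intro X Y
  refine Real.sqrt_le_sqrt (le_of_mul_le_mul_left ?_ (Nat.cast_pos.mpr (NeZero.pos n3)))
  rw [← sum_matFrobSq_fourierSlice, ← sum_matFrobSq_fourierSlice]
  refine Finset.sum_le_sum fun ω _ => ?_
  obtain ⟨s, hs, hs0, hSs⟩ := exists_fourierSlice_eq_rectDiagonal hS ω (hdiag ω) (hmono ω)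
  have hU1 : (fourierSlice U ω).conjTranspose * fourierSlice U ω = 1 := by
    rw [← fourierSlice_tT, ← fourierSlice_tProd, hU.1, fourierSlice_idT]
  have hU2 : fourierSlice U ω * (fourierSlice U ω).conjTranspose = 1 := by
    rw [← fourierSlice_tT, ← fourierSlice_tProd, hU.2, fourierSlice_idT]
  have hV1 : (fourierSlice V ω).conjTranspose * fourierSlice V ω = 1 := by
    rw [← fourierSlice_tT, ← fourierSlice_tProd, hV.1, fourierSlice_idT]
  have hV2 : fourierSlice V ω * (fourierSlice V ω).conjTranspose = 1 := by
    rw [← fourierSlice_tT, ← fourierSlice_tProd, hV.2, fourierSlice_idT]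
  rw [fourierSlice_sub, fourierSlice_sub, fourierSlice_truncT U S V _ _ hSs, hM,
    fourierSlice_tProd, fourierSlice_tProd, fourierSlice_tT, hSs, fourierSlice_tProd]
  generalize fourierSlice U ω = A at *
  generalize fourierSlice V ω = B at *
  have hsub : rectDiagonal n1 n2 s - rectDiagonal n1 n2 (fun i => if i < k then s i else 0) =
      rectDiagonal n1 n2 (fun i => if i < k then 0 else s i) := by
    ext i j
    by_cases hj : (j : ℕ) < k <;> by_cases hij : (i : ℕ) = j <;> simp [rectDiagonal, hj, hij]
  rw [← Matrix.sub_mul, ← Matrix.mul_sub, hsub, matFrobSq_mul_unitary (by simpa using hV1),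
    matFrobSq_unitary_mul hU1]
  refine (matFrobSq_rectDiagonal_sub_le (by omega) (by omega) hs hs0
    (A.conjTranspose * fourierSlice X ω) (fourierSlice Y ω * B)).trans_eq ?_
  rw [← matFrobSq_unitary_mul hU1,
    ← matFrobSq_mul_unitary (W := B.conjTranspose) (by simpa using hV1)]
  congr 1
  simp only [Matrix.mul_sub, Matrix.sub_mul, Matrix.mul_assoc, hV2, Matrix.mul_one]
  simp only [← Matrix.mul_assoc A, hU2, Matrix.one_mul]
end
end

section
/- A third-order tensor M ∈ ℝ^{n₁×n₂×n₃} can be factored as M = X*Y for some X ∈ ℝ^{n₁×k×n₃} and Y ∈ ℝ^{k×n₂×n₃} if and only if for every frequency ω ∈ ℤ/n₃ℤ the complex matrix M̂(:,:,ω) has rank at most k. -/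
open scoped BigOperators

noncomputable section

section Rank

variable {K : Type*} [Field K] {m n : Type*} [Fintype n]

/-- A matrix of rank at most `k` factors through `Fin k → K`. -/
theorem exists_eq_mul_of_rank_le {k : ℕ} (A : Matrix m n K) (h : A.rank ≤ k) :
    ∃ (X : Matrix m (Fin k) K) (Y : Matrix (Fin k) n K), A = X * Y := by
  classical
  have h' : Module.finrank K (LinearMap.range A.mulVecLin) ≤
      Module.finrank K (Fin k → K) := by
    rw [Module.finrank_fin_fun]; exact h
  obtain ⟨f, hf⟩ := finrank_le_iff_exists_linearMap.mp h'
  obtain ⟨g, hg⟩ := f.exists_leftInverse_of_injective (LinearMap.ker_eq_bot.mpr hf)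
  refine ⟨LinearMap.toMatrix' ((LinearMap.range A.mulVecLin).subtype ∘ₗ g),
    LinearMap.toMatrix' (f ∘ₗ A.mulVecLin.rangeRestrict), ?_⟩
  rw [← LinearMap.toMatrix'_comp, LinearMap.comp_assoc, ← LinearMap.comp_assoc _ f g, hg,
    LinearMap.id_comp, LinearMap.subtype_comp_codRestrict, ← Matrix.toLin'_apply',
    LinearMap.toMatrix'_toLin']

/-- A matrix of rank `r` has an identity block of size `r` up to multiplication on both sides. -/
theorem exists_mul_mul_eq_one_of_rank [Fintype m] (A : Matrix m n K) :
    ∃ (L : Matrix (Fin A.rank) m K) (R : Matrix n (Fin A.rank) K), L * A * R = 1 := by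
  classical
  let b : Module.Basis (Fin A.rank) K (LinearMap.range A.mulVecLin) := Module.finBasis K _
  choose e he using fun i => (b i).2
  have hli : LinearIndependent K fun i => (b i : m → K) :=
    b.linearIndependent.map' (LinearMap.range A.mulVecLin).subtype (Submodule.ker_subtype _)
  obtain ⟨g, hg⟩ := LinearMap.exists_leftInverse_of_injective
    (Fintype.linearCombination K fun i => (b i : m → K))
    (LinearMap.ker_eq_bot.mpr hli.fintypeLinearCombination_injective)
  refine ⟨LinearMap.toMatrix' g, LinearMap.toMatrix' (Fintype.linearCombination K e), ?_⟩
  have hcomp : A.mulVecLin ∘ₗ Fintype.linearCombination K e =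
      Fintype.linearCombination K fun i => (b i : m → K) := by
    ext i : 2
    simp [← he]
  have hA : A = LinearMap.toMatrix' A.mulVecLin := by
    rw [← Matrix.toLin'_apply', LinearMap.toMatrix'_toLin']
  have hAR : A * LinearMap.toMatrix' (Fintype.linearCombination K e) =
      LinearMap.toMatrix' (A.mulVecLin ∘ₗ Fintype.linearCombination K e) := by
    rw [LinearMap.toMatrix'_comp, ← hA]
  rw [Matrix.mul_assoc, hAR, hcomp, ← LinearMap.toMatrix'_comp, hg, LinearMap.toMatrix'_id]

/-- Extending scalars does not decrease the rank of a matrix. -/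
theorem rank_le_rank_map [Finite m] {F : Type*} [Field F] (f : K →+* F) (A : Matrix m n K) :
    A.rank ≤ (A.map f).rank := by
  have := Fintype.ofFinite m
  obtain ⟨L, R, h⟩ := exists_mul_mul_eq_one_of_rank A
  have h' : L.map f * A.map f * R.map f = 1 := by
    rw [← Matrix.map_mul, ← Matrix.map_mul, h, Matrix.map_one _ f.map_zero f.map_one]
  calc A.rank = (1 : Matrix (Fin A.rank) (Fin A.rank) F).rank := by
        rw [Matrix.rank_one, Fintype.card_fin]
    _ = (L.map f * A.map f * R.map f).rank := by rw [h']
    _ ≤ (L.map f * A.map f).rank := Matrix.rank_mul_le_left _ _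
    _ ≤ (A.map f).rank := Matrix.rank_mul_le_right _ _

end Rank

section ConjugateSymmetry

open scoped ComplexConjugate

variable {m n : Type*} [Finite m] [Fintype n]

/-- A complex matrix fixed by conjugation has a rank factorization fixed by conjugation. -/
theorem exists_conj_eq_mul_of_rank_le {k : ℕ} (A : Matrix m n ℂ) (hA : A.map conj = A)
    (h : A.rank ≤ k) :
    ∃ (X : Matrix m (Fin k) ℂ) (Y : Matrix (Fin k) n ℂ),
      A = X * Y ∧ X.map conj = X ∧ Y.map conj = Y := by
  have hre : (A.map Complex.re).map Complex.ofRealHom = A := by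
    ext i j
    exact Complex.conj_eq_iff_re.mp (congrFun (congrFun hA i) j)
  obtain ⟨X, Y, hXY⟩ := exists_eq_mul_of_rank_le (k := k) (A.map Complex.re)
    ((rank_le_rank_map Complex.ofRealHom _).trans (by rwa [hre]))
  refine ⟨X.map Complex.ofRealHom, Y.map Complex.ofRealHom, ?_, ?_, ?_⟩
  · rw [← Matrix.map_mul, ← hXY, hre]
  · ext i j; simp
  · ext i j; simp

/-- Keeping a family of matrices on one half of `ZMod N` and conjugating it onto the other half
gives a conjugate-symmetric family. -/
theorem conj_symm_ite {m n : Type*} {N : ℕ} [NeZero N] (Z : ZMod N → Matrix m n ℂ)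
    (hZ : ∀ ω, -ω = ω → (Z ω).map conj = Z ω) (ω : ZMod N) :
    (if (-ω).val ≤ (- -ω).val then Z (-ω) else (Z (- -ω)).map conj) =
      (if ω.val ≤ (-ω).val then Z ω else (Z (-ω)).map conj).map conj := by
  have hconj : ∀ B : Matrix m n ℂ, (B.map conj).map conj = B := fun B => by ext; simp
  rw [neg_neg]
  rcases lt_trichotomy ω.val (-ω).val with hlt | heq | hgt
  · rw [if_neg hlt.not_ge, if_pos hlt.le]
  · have hω : -ω = ω := (ZMod.val_injective N heq).symm
    simp only [hω, le_refl, if_true, hZ ω hω]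
  · rw [if_pos hgt.le, if_neg hgt.not_ge, hconj]

/-- A conjugate-symmetric family of matrices of rank at most `k` over `ZMod N` factors through
conjugate-symmetric families. -/
theorem exists_conj_symm_factorization {N k : ℕ} [NeZero N] (G : ZMod N → Matrix m n ℂ)
    (hG : ∀ ω, G (-ω) = (G ω).map conj) (h : ∀ ω, (G ω).rank ≤ k) :
    ∃ (P : ZMod N → Matrix m (Fin k) ℂ) (Q : ZMod N → Matrix (Fin k) n ℂ),
      (∀ ω, G ω = P ω * Q ω) ∧ (∀ ω, P (-ω) = (P ω).map conj) ∧
        ∀ ω, Q (-ω) = (Q ω).map conj := by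
  have key : ∀ ω, ∃ (X : Matrix m (Fin k) ℂ) (Y : Matrix (Fin k) n ℂ),
      G ω = X * Y ∧ (-ω = ω → X.map conj = X ∧ Y.map conj = Y) := by
    intro ω
    by_cases hω : -ω = ω
    · obtain ⟨X, Y, hXY, hX, hY⟩ :=
        exists_conj_eq_mul_of_rank_le (G ω) (by rw [← hG, hω]) (h ω)
      exact ⟨X, Y, hXY, fun _ => ⟨hX, hY⟩⟩
    · obtain ⟨X, Y, hXY⟩ := exists_eq_mul_of_rank_le (G ω) (h ω)
      exact ⟨X, Y, hXY, fun h' => absurd h' hω⟩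
  choose X Y hXY hfix using key
  refine ⟨fun ω => if ω.val ≤ (-ω).val then X ω else (X (-ω)).map conj,
    fun ω => if ω.val ≤ (-ω).val then Y ω else (Y (-ω)).map conj, fun ω => ?_,
    conj_symm_ite X fun ω hω => (hfix ω hω).1, conj_symm_ite Y fun ω hω => (hfix ω hω).2⟩
  dsimp only
  split_ifs
  · exact hXY ω
  · rw [← Matrix.map_mul, ← hXY, ← hG, neg_neg]

open ZMod in
/-- A conjugate-symmetric function on `ZMod N` is the Fourier transform of a real function. -/
theorem exists_real_dft_eq {N : ℕ} [NeZero N] (F : ZMod N → ℂ)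
    (hF : ∀ ω, F (-ω) = conj (F ω)) : ∃ a : ZMod N → ℝ, ZMod.dft (fun t => (a t : ℂ)) = F := by
  have hreal : ∀ t, conj (𝓕⁻ F t) = 𝓕⁻ F t := by
    intro t
    rw [invDFT_apply, smul_eq_mul, map_mul, map_inv₀, map_natCast, map_sum]
    congr 1
    rw [← Equiv.sum_comp (Equiv.neg (ZMod N))]
    refine Finset.sum_congr rfl fun j _ => ?_
    simp [hF, AddChar.map_neg_eq_conj]
  refine ⟨fun t => (𝓕⁻ F t).re, ?_⟩
  have : (fun t => ((𝓕⁻ F t).re : ℂ)) = 𝓕⁻ F :=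
    funext fun t => Complex.conj_eq_iff_re.mp (hreal t)
  rw [this, LinearEquiv.apply_symm_apply]

end ConjugateSymmetry

section TensorDFT

open scoped ComplexConjugate

variable {n1 n2 n3 n4 : ℕ} [NeZero n3]

theorem dft_eq_zmod_dft (A : T3 n1 n2 n3) (i : Fin n1) (j : Fin n2) :
    dft A i j = ZMod.dft fun t => (A i j t : ℂ) := by
  ext ω
  rw [ZMod.dft_apply, dft]
  refine Finset.sum_congr rfl fun t _ => ?_
  have h : -(t * ω) = ((-(ω.val * t.val : ℤ) : ℤ) : ZMod n3) := by
    push_cast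
    rw [ZMod.natCast_zmod_val, ZMod.natCast_zmod_val, mul_comm]
  rw [h, ZMod.stdAddChar_coe, smul_eq_mul, mul_comm]
  push_cast
  congr 2
  ring

theorem dft_injective {A B : T3 n1 n2 n3} (h : ∀ i j, dft A i j = dft B i j) : A = B := by
  ext i j t
  have h' := h i j
  rw [dft_eq_zmod_dft, dft_eq_zmod_dft] at h'
  exact Complex.ofReal_injective (congrFun (ZMod.dft.injective h') t)

theorem dft_neg (A : T3 n1 n2 n3) (i : Fin n1) (j : Fin n2) (ω : ZMod n3) :
    dft A i j (-ω) = conj (dft A i j ω) := by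
  simp [dft_eq_zmod_dft, ZMod.dft_apply, AddChar.map_neg_eq_conj]

/-- The DFT turns the t-product into the slicewise matrix product. -/
theorem dft_tProd (A : T3 n1 n2 n3) (B : T3 n2 n4 n3) (i : Fin n1) (j : Fin n4) (ω : ZMod n3) :
    dft (tProd A B) i j ω = ∑ l, dft A i l ω * dft B l j ω := by
  simp only [dft_eq_zmod_dft, ZMod.dft_apply, tProd, smul_eq_mul]
  push_cast
  simp only [Finset.mul_sum]
  rw [Finset.sum_comm]
  refine Finset.sum_congr rfl fun l _ => ?_
  rw [Finset.sum_comm, ← Finset.mul_sum, Finset.sum_mul_sum]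
  refine Finset.sum_congr rfl fun s _ => ?_
  rw [← Equiv.sum_comp (Equiv.addRight s)]
  refine Finset.sum_congr rfl fun t _ => ?_
  have h : -((t + s) * ω) = -(s * ω) + -(t * ω) := by ring
  rw [Equiv.coe_addRight, h, AddChar.map_add_eq_mul, add_sub_cancel_right]
  ring

/-- A conjugate-symmetric family of matrices is the DFT of a real tensor. -/
theorem exists_dft_eq (P : ZMod n3 → Matrix (Fin n1) (Fin n2) ℂ)
    (hP : ∀ ω, P (-ω) = (P ω).map conj) : ∃ A : T3 n1 n2 n3, ∀ i j ω, dft A i j ω = P ω i j := by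
  choose A hA using fun i j => exists_real_dft_eq (fun ω => P ω i j) fun ω => by
    rw [hP, Matrix.map_apply]
  exact ⟨A, fun i j ω => by rw [dft_eq_zmod_dft, hA]⟩

end TensorDFT

/-- `M` factors as `M = X*Y` with `X ∈ ℝ^{n₁×k×n₃}` and
`Y ∈ ℝ^{k×n₂×n₃}` iff every frontal slice `M̂(:,:,ω)` has rank at most `k`. -/
theorem tProd_factorization_iff_rank {n1 n2 n3 k : ℕ} [NeZero n3]
    (M : T3 n1 n2 n3) :
    (∃ (X : T3 n1 k n3) (Y : T3 k n2 n3), M = tProd X Y) ↔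
      ∀ ω : ZMod n3, (Matrix.of fun i j => dft M i j ω).rank ≤ k := by
  constructor
  · rintro ⟨X, Y, rfl⟩ ω
    have h : (Matrix.of fun i j => dft (tProd X Y) i j ω) =
        (Matrix.of fun i l => dft X i l ω) * (Matrix.of fun l j => dft Y l j ω) := by
      ext i j
      simp [Matrix.mul_apply, dft_tProd]
    rw [h]
    exact (Matrix.rank_mul_le_left _ _).trans (Matrix.rank_le_width _)
  · intro h
    obtain ⟨P, Q, hPQ, hP, hQ⟩ := exists_conj_symm_factorization
      (fun ω => Matrix.of fun i j => dft M i j ω)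
      (fun ω => by ext i j; simp [dft_neg]) h
    obtain ⟨X, hX⟩ := exists_dft_eq P hP
    obtain ⟨Y, hY⟩ := exists_dft_eq Q hQ
    refine ⟨X, Y, dft_injective fun i j => funext fun ω => ?_⟩
    simp only [dft_tProd, hX, hY]
    exact congrFun (congrFun (hPQ ω) i) j
end
end
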